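/- arXiv:1602.00459 — 6 statements merged into one kernel-verified Lean document; each statement's English description precedes it below -/
import Mathlib

section
/- Let (u_i)_{i∈ℤ} and (v_i)_{i∈ℤ} be grid functions with Σ_{i∈ℤ}(u_i − v_i) = 0 and Σ_{i∈ℤ} |i| |u_i − v_i| < ∞. Then W_{1,D}(u_{Δx}, v_{Δx}) = Σ_{i∈ℤ} | Σ_{j<i} (u_j − v_j) | Δx²; that is, the supremum over discrete Lipschitz test functions equals the weighted sum of absolute partial sums. -/
/-- The discrete Wasserstein distance (DLip′-distance) between two grid functions
`u v : ℤ → ℝ` on a grid of size `Δx`: the supremum of `Σ φᵢ (uᵢ - vᵢ) Δx` over all grid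
test functions with `|φ_{i+1} - φ_i| ≤ Δx` for all `i`. -/
noncomputable def W1D (Δx : ℝ) (u v : ℤ → ℝ) : ℝ :=
  sSup {r : ℝ | ∃ φ : ℤ → ℝ, (∀ i, |φ (i + 1) - φ i| ≤ Δx) ∧
    r = ∑' i : ℤ, φ i * (u i - v i) * Δx}

/-- The signed indicator of the edges `i → i + 1` on the path from `0` to `j`. -/
noncomputable def edgeSign (i j : ℤ) : ℝ :=
  (if 0 ≤ i then 1 else 0) - (if j ≤ i then 1 else 0)

lemma edgeSign_zero_right (i : ℤ) : edgeSign i 0 = 0 := by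
  simp [edgeSign]

lemma edgeSign_add_one_right (i j : ℤ) :
    edgeSign i (j + 1) = edgeSign i j + if i = j then 1 else 0 := by
  unfold edgeSign
  split_ifs <;> first | omega | norm_num

lemma abs_edgeSign (i j : ℤ) :
    |edgeSign i j| = edgeSign i j * (|((i + 1 : ℤ) : ℝ)| - |(i : ℝ)|) := by
  rcases le_or_gt 0 i with hi | hi
  · have h : |((i + 1 : ℤ) : ℝ)| - |(i : ℝ)| = 1 := by
      have : (0 : ℝ) ≤ i := by exact_mod_cast hi
      push_cast
      rw [abs_of_nonneg this, abs_of_nonneg (by linarith)]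
      ring
    rw [h]
    unfold edgeSign
    split_ifs <;> norm_num
  · have h : |((i + 1 : ℤ) : ℝ)| - |(i : ℝ)| = -1 := by
      have h1 : ((i + 1 : ℤ) : ℝ) ≤ 0 := by exact_mod_cast hi
      have h2 : (i : ℝ) ≤ 0 := by exact_mod_cast hi.le
      rw [abs_of_nonpos h1, abs_of_nonpos h2]
      push_cast
      ring
    rw [h]
    unfold edgeSign
    split_ifs <;> first | omega | norm_num

lemma hasSum_edgeSign_mul_sub (φ : ℤ → ℝ) (j : ℤ) :
    HasSum (fun i => edgeSign i j * (φ (i + 1) - φ i)) (φ j - φ 0) := by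
  have hstep (j : ℤ) : HasSum (fun i => if i = j then φ (i + 1) - φ i else 0)
      (φ (j + 1) - φ j) := by
    convert hasSum_ite_eq j (φ (j + 1) - φ j) using 2 with i
    split_ifs with h <;> simp [h]
  induction j using Int.induction_on with
  | zero => simp [edgeSign_zero_right, hasSum_zero]
  | succ n ih =>
    convert ih.add (hstep n) using 1
    · ext i
      rw [edgeSign_add_one_right]
      split_ifs <;> ring
    · ring
  | pred n ih =>
    convert ih.sub (hstep (-n - 1)) using 1
    · rfl
    · ext i
      have := edgeSign_add_one_right i (-n - 1)
      rw [sub_add_cancel] at this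
      rw [this]
      split_ifs <;> ring
    · rw [sub_add_cancel]
      ring

lemma hasSum_abs_edgeSign (j : ℤ) : HasSum (fun i => |edgeSign i j|) |(j : ℝ)| := by
  simpa [abs_edgeSign] using hasSum_edgeSign_mul_sub (fun i => |(i : ℝ)|) j

lemma exists_forward_difference_eq (d : ℤ → ℝ) : ∃ φ : ℤ → ℝ, ∀ i, φ (i + 1) - φ i = d i := by
  have hsumm (j : ℤ) : Summable (fun i => edgeSign i j * d i) := by
    refine summable_of_ne_finset_zero (s := Finset.Ico 0 j ∪ Finset.Ico j 0) fun i hi => ?_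
    simp only [Finset.mem_union, Finset.mem_Ico] at hi
    unfold edgeSign
    split_ifs <;> first | omega | simp
  refine ⟨fun j => ∑' i, edgeSign i j * d i, fun j => ?_⟩
  dsimp only
  rw [← (hsumm (j + 1)).tsum_sub (hsumm j), ← tsum_ite_eq j (fun i => d i)]
  refine tsum_congr fun i => ?_
  rw [edgeSign_add_one_right]
  split_ifs <;> ring

lemma hasSum_edgeSign_mul_right {w : ℤ → ℝ} (hw : HasSum w 0) (i : ℤ) :
    HasSum (fun j => edgeSign i j * w j) (-∑' j : {j : ℤ // j < i + 1}, w j) := by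
  have hF : HasSum ({j : ℤ | j < i + 1}.indicator w) (∑' j : {j : ℤ // j < i + 1}, w j) := by
    have := (hw.summable.indicator {j : ℤ | j < i + 1}).hasSum
    rwa [← tsum_subtype] at this
  convert (hw.mul_left (if 0 ≤ i then 1 else 0)).sub hF using 1
  · rfl
  · ext j
    simp only [edgeSign, Set.indicator, Set.mem_ofPred_eq, Int.lt_add_one_iff]
    split_ifs <;> ring
  · ring

lemma summable_edgeSign_mul {w : ℤ → ℝ} (hmom : Summable (fun i : ℤ => |(i : ℝ)| * |w i|))
    {d : ℤ → ℝ} {C : ℝ} (hd : ∀ i, |d i| ≤ C) :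
    Summable (fun p : ℤ × ℤ => edgeSign p.2 p.1 * d p.2 * w p.1) := by
  have habs : Summable (fun p : ℤ × ℤ => |edgeSign p.2 p.1| * |w p.1|) := by
    refine (summable_prod_of_nonneg fun p => by positivity).2
      ⟨fun j => ((hasSum_abs_edgeSign j).mul_right |w j|).summable, ?_⟩
    convert hmom using 2 with j
    exact ((hasSum_abs_edgeSign j).mul_right |w j|).tsum_eq
  refine (habs.mul_left C).of_norm_bounded fun p => ?_
  rw [Real.norm_eq_abs, abs_mul, abs_mul]
  calc |edgeSign p.2 p.1| * |d p.2| * |w p.1| = |d p.2| * (|edgeSign p.2 p.1| * |w p.1|) := by ring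
    _ ≤ C * (|edgeSign p.2 p.1| * |w p.1|) := by gcongr; exact hd _

/-- Summation by parts over `ℤ` for a zero-sum sequence with finite first moment against a
sequence with bounded differences. -/
lemma exists_hasSum_summation_by_parts {w : ℤ → ℝ} (hw : HasSum w 0)
    (hmom : Summable (fun i : ℤ => |(i : ℝ)| * |w i|))
    {φ : ℤ → ℝ} {C : ℝ} (hφ : ∀ i, |φ (i + 1) - φ i| ≤ C) :
    ∃ S, HasSum (fun j => φ j * w j) S ∧
      HasSum (fun i => (φ i - φ (i + 1)) * ∑' j : {j : ℤ // j < i + 1}, w j) S := by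
  obtain ⟨S, hS⟩ := summable_edgeSign_mul hmom hφ
  refine ⟨S, ?_, ?_⟩
  · have h := hS.prod_fiberwise fun j => (hasSum_edgeSign_mul_sub φ j).mul_right (w j)
    convert h.add (hw.mul_left (φ 0)) using 1
    · ext j
      ring
    · ring
  · exact ((Equiv.prodComm ℤ ℤ).hasSum_iff.2 hS).prod_fiberwise
      (g := fun i => (φ i - φ (i + 1)) * ∑' j : {j : ℤ // j < i + 1}, w j) fun i => by
        convert (hasSum_edgeSign_mul_right hw i).mul_left (φ (i + 1) - φ i) using 1
        · rfl
        · ext j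
          simp only [Function.comp_apply, Equiv.prodComm_apply, Prod.swap_prod_mk]
          ring
        · ring

/-- The discrete Wasserstein distance equals the `Δx²`-weighted sum of the absolute values
of the partial sums `Σ_{j<i} (uⱼ - vⱼ)`. -/
theorem discrete_wasserstein_eq_sum_abs_partial_sums
    (Δx : ℝ) (hΔx : 0 < Δx) (u v : ℤ → ℝ)
    (hsum : Summable (fun i : ℤ => u i - v i))
    (hzero : (∑' i : ℤ, (u i - v i)) = 0)
    (hmom : Summable (fun i : ℤ => |(i : ℝ)| * |u i - v i|)) :
    W1D Δx u v = ∑' i : ℤ, |∑' j : {j : ℤ // j < i}, (u j.1 - v j.1)| * Δx ^ 2 := by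
  have hw : HasSum (fun i => u i - v i) 0 := hzero ▸ hsum.hasSum
  set F : ℤ → ℝ := fun i => ∑' j : {j : ℤ // j < i}, (u j.1 - v j.1)
  change W1D Δx u v = ∑' i, |F i| * Δx ^ 2
  rw [← (Equiv.addRight (1 : ℤ)).tsum_eq (fun i => |F i| * Δx ^ 2)]
  simp only [Equiv.coe_addRight]
  obtain ⟨φ, hφ⟩ := exists_forward_difference_eq fun i => -(Δx * SignType.sign (F (i + 1)))
  have hφ_lip (i : ℤ) : |φ (i + 1) - φ i| ≤ Δx := by
    rw [hφ, abs_neg, abs_mul, abs_of_pos hΔx]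
    refine mul_le_of_le_one_right hΔx.le ?_
    rcases lt_trichotomy (F (i + 1)) 0 with h | h | h <;> simp [h]
  obtain ⟨S, hS, hSF⟩ := exists_hasSum_summation_by_parts hw hmom hφ_lip
  have hmax : HasSum (fun i => |F (i + 1)| * Δx ^ 2) (S * Δx) := by
    convert hSF.mul_right Δx using 1
    · rfl
    ext i
    change _ = (φ i - φ (i + 1)) * F (i + 1) * Δx
    rw [← neg_sub (φ (i + 1)), hφ, neg_neg, ← sign_mul_self (F (i + 1))]
    ring
  rw [hmax.tsum_eq]
  refine IsGreatest.csSup_eq ⟨⟨φ, hφ_lip, (hS.mul_right Δx).tsum_eq.symm⟩, ?_⟩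
  rintro _ ⟨ψ, hψ, rfl⟩
  obtain ⟨T, hT, hTF⟩ := exists_hasSum_summation_by_parts hw hmom hψ
  rw [(hT.mul_right Δx).tsum_eq]
  refine hasSum_le (fun i => ?_) (hTF.mul_right Δx) hmax
  calc (ψ i - ψ (i + 1)) * F (i + 1) * Δx ≤ |ψ (i + 1) - ψ i| * |F (i + 1)| * Δx := by
        rw [abs_sub_comm, ← abs_mul]
        gcongr
        exact le_abs_self _
    _ ≤ Δx * |F (i + 1)| * Δx := by gcongr; exact hψ i
    _ = |F (i + 1)| * Δx ^ 2 := by ring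
end

section
/- Let u_{Δx} and v_{Δx} be piecewise constant grid functions with Σ_{i∈ℤ}(u_i − v_i) = 0 and Σ_{i∈ℤ} |i| |u_i − v_i| < ∞. Then W₁(u_{Δx}, v_{Δx}) ≤ W_{1,D}(u_{Δx}, v_{Δx}). -/
open MeasureTheory

/-- The Wasserstein distance (Lip′-norm) between two functions `u v : ℝ → ℝ`. -/
noncomputable def W1 (u v : ℝ → ℝ) : ℝ :=
  sSup {r : ℝ | ∃ φ : ℝ → ℝ, LipschitzWith 1 φ ∧ r = ∫ x : ℝ, φ x * (u x - v x)}

/-- The piecewise constant function associated to a grid function `u : ℤ → ℝ`: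
it takes the value `u i` on the cell `I_i = [(i - 1/2)Δx, (i + 1/2)Δx)`. -/
noncomputable def pc (Δx : ℝ) (u : ℤ → ℝ) : ℝ → ℝ :=
  fun x => u ⌊x / Δx + 1 / 2⌋

/-- The increments of a grid function bound its growth linearly. -/
theorem abs_sub_zero_le_of_abs_succ_sub_le {h : ℝ} {φ : ℤ → ℝ}
    (hφ : ∀ i, |φ (i + 1) - φ i| ≤ h) (i : ℤ) : |φ i - φ 0| ≤ h * |(i : ℝ)| := by
  have hh : 0 ≤ h := (abs_nonneg _).trans (hφ 0)
  induction i using Int.induction_on with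
  | zero => simp
  | succ n ih =>
    have h1 := abs_sub_le (φ (n + 1)) (φ n) (φ 0)
    have h2 := hφ n
    push_cast at ih ⊢
    rw [Nat.abs_cast] at ih
    rw [abs_of_nonneg (by positivity : (0 : ℝ) ≤ n + 1)]
    linarith
  | pred n ih =>
    have h1 := abs_sub_le (φ (-n - 1)) (φ (-n)) (φ 0)
    have h2 := hφ (-n - 1)
    rw [sub_add_cancel, abs_sub_comm] at h2
    have h3 : |((-(n : ℤ) - 1 : ℤ) : ℝ)| = n + 1 := by
      push_cast
      rw [abs_of_nonpos (by linarith [(n.cast_nonneg : (0 : ℝ) ≤ n)])]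
      ring
    push_cast at ih
    rw [abs_neg, Nat.abs_cast] at ih
    rw [h3]
    linarith

/-- Discrete test functions pair boundedly with a grid function of zero mass and finite first
moment. -/
theorem tsum_mul_le_of_abs_succ_sub_le {h : ℝ} {φ w : ℤ → ℝ}
    (hφ : ∀ i, |φ (i + 1) - φ i| ≤ h) (hsum : Summable w) (hzero : ∑' i, w i = 0)
    (hmom : Summable fun i : ℤ => |(i : ℝ)| * |w i|) :
    ∑' i, φ i * w i ≤ h * ∑' i : ℤ, |(i : ℝ)| * |w i| := by
  have hbound (i : ℤ) : ‖(φ i - φ 0) * w i‖ ≤ h * (|(i : ℝ)| * |w i|) := by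
    rw [Real.norm_eq_abs, abs_mul, ← mul_assoc]
    gcongr
    exact abs_sub_zero_le_of_abs_succ_sub_le hφ i
  have hs : Summable fun i => (φ i - φ 0) * w i := (hmom.mul_left h).of_norm_bounded hbound
  calc ∑' i, φ i * w i = ∑' i, ((φ i - φ 0) * w i + φ 0 * w i) := by
        congr with i
        ring
    _ = ∑' i, (φ i - φ 0) * w i := by
        rw [hs.tsum_add (hsum.mul_left _), tsum_mul_left, hzero, mul_zero, add_zero]
    _ ≤ ∑' i : ℤ, h * (|(i : ℝ)| * |w i|) :=
        hs.tsum_le_tsum (fun i => (le_abs_self _).trans (hbound i)) (hmom.mul_left h)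
    _ = h * ∑' i : ℤ, |(i : ℝ)| * |w i| := tsum_mul_left

/-- The average of `φ` over the `i`-th grid cell. -/
noncomputable def cellAverage (Δx : ℝ) (φ : ℝ → ℝ) (i : ℤ) : ℝ :=
  ∫ t in (0 : ℝ)..1, φ ((t + i - 1 / 2) * Δx)

theorem LipschitzWith.abs_cellAverage_succ_sub_le {Δx : ℝ} (hΔx : 0 ≤ Δx) {φ : ℝ → ℝ}
    (hφ : LipschitzWith 1 φ) (i : ℤ) :
    |cellAverage Δx φ (i + 1) - cellAverage Δx φ i| ≤ Δx := by
  have hint (j : ℤ) :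
      IntervalIntegrable (fun t : ℝ => φ ((t + j - 1 / 2) * Δx)) volume 0 1 :=
    (hφ.continuous.comp (by fun_prop)).intervalIntegrable _ _
  rw [cellAverage, cellAverage, ← intervalIntegral.integral_sub (hint _) (hint _),
    ← Real.norm_eq_abs]
  refine (intervalIntegral.norm_integral_le_of_norm_le_const (C := Δx) fun t _ => ?_).trans
    (by simp)
  have h := hφ.dist_le_mul ((t + (i + 1 : ℤ) - 1 / 2) * Δx) ((t + i - 1 / 2) * Δx)
  rw [dist_eq_norm, Real.dist_eq] at h
  refine h.trans (le_of_eq ?_)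
  push_cast
  rw [one_mul, show (t + (i + 1) - 1 / 2) * Δx - (t + i - 1 / 2) * Δx = Δx by ring,
    abs_of_nonneg hΔx]

/-- Integrating against a piecewise constant function amounts to summing cell averages. -/
theorem hasSum_cellAverage_mul {Δx : ℝ} (hΔx : 0 < Δx) {φ : ℝ → ℝ} {w : ℤ → ℝ}
    (hint : Integrable fun x => φ x * pc Δx w x) :
    HasSum (fun i => cellAverage Δx φ i * w i * Δx) (∫ x, φ x * pc Δx w x) := by
  set f : ℝ → ℝ := fun x => φ x * pc Δx w x with hf
  have hF : Integrable fun y => f ((y - 1 / 2) * Δx) :=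
    (hint.comp_mul_right' hΔx.ne').comp_sub_right (1 / 2)
  have hF_integral : (∫ y, f ((y - 1 / 2) * Δx)) * Δx = ∫ x, f x := by
    rw [integral_sub_right_eq_self (fun y => f (y * Δx)), Measure.integral_comp_mul_right,
      abs_of_pos (inv_pos.2 hΔx), smul_eq_mul]
    field_simp
  have hcell (i : ℤ) :
      cellAverage Δx φ i * w i = ∫ t in (0 : ℝ)..1, f ((t + i - 1 / 2) * Δx) := by
    rw [cellAverage, ← intervalIntegral.integral_mul_const]
    refine intervalIntegral.integral_congr_Ioo_of_le zero_le_one fun t ht => ?_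
    have hfloor : ⌊(t + i - 1 / 2) * Δx / Δx + 1 / 2⌋ = i := by
      rw [mul_div_cancel_right₀ _ hΔx.ne', sub_add_cancel, Int.floor_add_intCast,
        Int.floor_eq_zero_iff.2 ⟨ht.1.le, ht.2⟩, zero_add]
    simp only [hf, pc, hfloor]
  simp only [← hF_integral, hcell]
  exact hF.hasSum_intervalIntegral_comp_add_int.mul_right Δx

/-- The Wasserstein distance between two piecewise constant grid functions is bounded by
their discrete Wasserstein distance. -/
theorem wasserstein_le_discrete_wasserstein
    (Δx : ℝ) (hΔx : 0 < Δx) (u v : ℤ → ℝ)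
    (hsum : Summable (fun i : ℤ => u i - v i))
    (hzero : (∑' i : ℤ, (u i - v i)) = 0)
    (hmom : Summable (fun i : ℤ => |(i : ℝ)| * |u i - v i|)) :
    W1 (pc Δx u) (pc Δx v) ≤ W1D Δx u v := by
  have hbdd : BddAbove {r : ℝ | ∃ φ : ℤ → ℝ, (∀ i, |φ (i + 1) - φ i| ≤ Δx) ∧
      r = ∑' i : ℤ, φ i * (u i - v i) * Δx} := by
    refine ⟨Δx * (∑' i : ℤ, |(i : ℝ)| * |u i - v i|) * Δx, ?_⟩
    rintro _ ⟨φ, hφ, rfl⟩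
    rw [tsum_mul_right]
    exact mul_le_mul_of_nonneg_right (tsum_mul_le_of_abs_succ_sub_le hφ hsum hzero hmom) hΔx.le
  refine csSup_le ⟨_, 0, LipschitzWith.const' 0, rfl⟩ ?_
  rintro _ ⟨φ, hφ, rfl⟩
  by_cases hint : Integrable fun x => φ x * pc Δx (fun i => u i - v i) x
  · exact le_csSup hbdd ⟨cellAverage Δx φ, hφ.abs_cellAverage_succ_sub_le hΔx.le,
      (hasSum_cellAverage_mul hΔx hint).tsum_eq.symm⟩
  · exact le_csSup hbdd ⟨0, by simp [hΔx.le], by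
      simpa [pc] using integral_undef hint⟩
end

section
/- Let u_{Δx} and v_{Δx} be piecewise constant grid functions with Σ_{i∈ℤ}(u_i − v_i) = 0 and Σ_{i∈ℤ} |i| |u_i − v_i| < ∞. If additionally ∫_{−∞}^x (u_{Δx} − v_{Δx})(y) dy ≥ 0 for all x ∈ ℝ (or ≤ 0 for all x ∈ ℝ), then W₁(u_{Δx}, v_{Δx}) = W_{1,D}(u_{Δx}, v_{Δx}). -/
open MeasureTheory

section Discrete

lemma summable_ite_le {w : ℤ → ℝ} (hw : Summable w) (n : ℤ) :
    Summable fun i : ℤ => if i ≤ n then w i else 0 :=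
  (hw.indicator {i | i ≤ n}).congr fun i => by simp [Set.indicator]

/-- The nondecreasing `Φ` pairs nonpositively with a zero-mean sequence whose partial sums from
`-∞` are nonnegative, when `Φ` is frozen outside `[-N, N]`. -/
lemma tsum_clamp_mul_nonpos {w : ℤ → ℝ} (hw : Summable w) (h0 : ∑' i, w i = 0)
    (hF : ∀ n : ℤ, 0 ≤ ∑' i, if i ≤ n then w i else 0)
    {Φ : ℤ → ℝ} (hΦ : ∀ i, Φ i ≤ Φ (i + 1)) (N : ℕ) :
    (Summable fun i : ℤ => Φ (max (-N) (min i N)) * w i) ∧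
      ∑' i : ℤ, Φ (max (-N) (min i N)) * w i ≤ 0 := by
  have hs := summable_ite_le hw
  induction N with
  | zero =>
    have h (i : ℤ) : max (-((0 : ℕ) : ℤ)) (min i ((0 : ℕ) : ℤ)) = 0 := by simp
    simp only [h]
    exact ⟨hw.mul_left _, by rw [tsum_mul_left, h0, mul_zero]⟩
  | succ N ih =>
    obtain ⟨hsN, hN⟩ := ih
    have key (i : ℤ) : Φ (max (-(N + 1 : ℕ)) (min i (N + 1 : ℕ))) * w i =
        Φ (max (-N) (min i N)) * w i
          + ((Φ (N + 1) - Φ N) * (w i - if i ≤ N then w i else 0)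
          - (Φ (-N) - Φ (-N - 1)) * if i ≤ -(N : ℤ) - 1 then w i else 0) := by
      push_cast
      rcases le_or_gt i (-(N : ℤ) - 1) with h | h
      · rw [if_pos (by omega), if_pos h, show max (-((N : ℤ) + 1)) (min i (N + 1)) = -N - 1 by omega,
          show max (-(N : ℤ)) (min i N) = -N by omega]
        ring
      · rcases le_or_gt i N with h' | h'
        · rw [if_pos h', if_neg (by omega), show max (-((N : ℤ) + 1)) (min i (N + 1)) = i by omega,
            show max (-(N : ℤ)) (min i N) = i by omega]
          ring
        · rw [if_neg (by omega), if_neg (by omega),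
            show max (-((N : ℤ) + 1)) (min i (N + 1)) = N + 1 by omega,
            show max (-(N : ℤ)) (min i N) = N by omega]
          ring
    simp only [key]
    have s1 := (hw.sub (hs N)).mul_left (Φ (N + 1) - Φ N)
    have s2 := (hs (-(N : ℤ) - 1)).mul_left (Φ (-N) - Φ (-N - 1))
    refine ⟨hsN.add (s1.sub s2), ?_⟩
    rw [hsN.tsum_add (s1.sub s2), s1.tsum_sub s2, tsum_mul_left, tsum_mul_left,
      hw.tsum_sub (hs N), h0]
    have d1 := mul_nonneg (sub_nonneg.2 (hΦ N)) (hF N)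
    have d2 : 0 ≤ (Φ (-N) - Φ (-N - 1)) * ∑' i, if i ≤ -(N : ℤ) - 1 then w i else 0 :=
      mul_nonneg (sub_nonneg.2 (by simpa using hΦ (-N - 1))) (hF _)
    linarith

lemma abs_le_of_abs_sub_le {Φ : ℤ → ℝ} {C : ℝ} (hΦ : ∀ i, |Φ (i + 1) - Φ i| ≤ C) (i : ℤ) :
    |Φ i| ≤ |Φ 0| + C * |(i : ℝ)| := by
  induction i with
  | zero => simp
  | succ n ih =>
    have h1 : |Φ (n + 1)| ≤ |Φ n| + |Φ (n + 1) - Φ n| := by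
      simpa using abs_add_le (Φ n) (Φ (n + 1) - Φ n)
    have h2 : |((n + 1 : ℤ) : ℝ)| = |((n : ℤ) : ℝ)| + 1 := by
      push_cast
      rw [abs_of_nonneg (by positivity), abs_of_nonneg (by positivity)]
    rw [h2]
    linarith [hΦ n]
  | pred n ih =>
    have h1 : |Φ (-n - 1)| ≤ |Φ (-n)| + |Φ (-n - 1 + 1) - Φ (-n - 1)| := by
      have := abs_sub (Φ (-n)) (Φ (-n - 1 + 1) - Φ (-n - 1))
      simpa using this
    have h2 : |((-n - 1 : ℤ) : ℝ)| = |((-n : ℤ) : ℝ)| + 1 := by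
      push_cast
      rw [abs_of_nonpos (by linarith [(Nat.cast_nonneg n : (0 : ℝ) ≤ n)]),
        abs_of_nonpos (by simp)]
      ring
    rw [h2]
    linarith [hΦ (-n - 1)]

lemma summable_mul_of_abs_sub_le {w : ℤ → ℝ} (hw : Summable w)
    (hm : Summable fun i : ℤ => |(i : ℝ)| * |w i|) {Φ : ℤ → ℝ} {C : ℝ}
    (hΦ : ∀ i, |Φ (i + 1) - Φ i| ≤ C) : Summable fun i => Φ i * w i := by
  refine Summable.of_norm_bounded ((hw.abs.mul_left |Φ 0|).add (hm.mul_left C)) fun i => ?_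
  rw [Real.norm_eq_abs, abs_mul]
  have := mul_le_mul_of_nonneg_right (abs_le_of_abs_sub_le hΦ i) (abs_nonneg (w i))
  linarith

lemma tsum_mul_nonpos_of_monotone {w : ℤ → ℝ} (hw : Summable w) (h0 : ∑' i, w i = 0)
    (hm : Summable fun i : ℤ => |(i : ℝ)| * |w i|)
    (hF : ∀ n : ℤ, 0 ≤ ∑' i, if i ≤ n then w i else 0)
    {Φ : ℤ → ℝ} {C : ℝ} (hC : 0 ≤ C) (hΦ : ∀ i, Φ i ≤ Φ (i + 1))
    (hΦC : ∀ i, |Φ (i + 1) - Φ i| ≤ C) :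
    ∑' i, Φ i * w i ≤ 0 := by
  have lim : Filter.Tendsto (fun N : ℕ => ∑' i : ℤ, Φ (max (-N) (min i N)) * w i) Filter.atTop
      (nhds (∑' i, Φ i * w i)) := by
    refine tendsto_tsum_of_dominated_convergence
      ((hw.abs.mul_left |Φ 0|).add (hm.mul_left C)) (fun i => ?_) (.of_forall fun N i => ?_)
    · refine tendsto_const_nhds.congr' ?_
      filter_upwards [Filter.eventually_ge_atTop i.natAbs] with N hN
      rw [show max (-(N : ℤ)) (min i N) = i by omega]
    · rw [Real.norm_eq_abs, abs_mul]
      have h1 : |((max (-(N : ℤ)) (min i N) : ℤ) : ℝ)| ≤ |(i : ℝ)| := by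
        have : |max (-(N : ℤ)) (min i N)| ≤ |i| := by
          rw [abs_le]
          constructor <;> cases abs_cases i <;> omega
        exact_mod_cast this
      have h2 := abs_le_of_abs_sub_le hΦC (max (-(N : ℤ)) (min i N))
      have h3 := mul_le_mul_of_nonneg_left h1 hC
      have := mul_le_mul_of_nonneg_right (h2.trans (add_le_add_right h3 _)) (abs_nonneg (w i))
      linarith
  exact le_of_tendsto' lim fun N => (tsum_clamp_mul_nonpos hw h0 hF hΦ N).2

end Discrete

section Cells

variable {Δx : ℝ}

lemma floor_eq_iff_mem_cell (hΔx : 0 < Δx) (x : ℝ) (i : ℤ) :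
    ⌊x / Δx + 1 / 2⌋ = i ↔ x ∈ Set.Ico (((i : ℝ) - 1 / 2) * Δx) (((i : ℝ) + 1 / 2) * Δx) := by
  rw [Int.floor_eq_iff, Set.mem_Ico, ← le_div_iff₀ hΔx, ← div_lt_iff₀ hΔx]
  constructor <;> rintro ⟨h, h'⟩ <;> constructor <;> linarith

lemma integral_mul_pc (hΔx : 0 < Δx) {φ : ℝ → ℝ} (hφ : LipschitzWith 1 φ) {a : ℤ → ℝ}
    (ha : Summable a) (hm : Summable fun i : ℤ => |(i : ℝ)| * |a i|) :
    ∫ x, φ x * pc Δx a x =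
      ∑' i : ℤ, (∫ x in (((i : ℝ) - 1 / 2) * Δx)..(((i : ℝ) + 1 / 2) * Δx), φ x) * a i := by
  set I : ℤ → Set ℝ := fun i => Set.Ico (((i : ℝ) - 1 / 2) * Δx) (((i : ℝ) + 1 / 2) * Δx) with hI
  have mem (x : ℝ) (i : ℤ) : ⌊x / Δx + 1 / 2⌋ = i ↔ x ∈ I i := floor_eq_iff_mem_cell hΔx x i
  have hIm (i : ℤ) : MeasurableSet (I i) := measurableSet_Ico
  have hU : ⋃ i, I i = Set.univ :=
    Set.eq_univ_of_forall fun x => Set.mem_iUnion.2 ⟨_, (mem x _).1 rfl⟩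
  have hd : Pairwise (Function.onFun Disjoint I) := fun i j hij =>
    Set.disjoint_left.2 fun x hi hj => hij (((mem x i).2 hi).symm.trans ((mem x j).2 hj))
  have heq (i : ℤ) : Set.EqOn (fun x => φ x * a i) (fun x => φ x * pc Δx a x) (I i) :=
    fun x hx => by simp only [pc, (mem x i).2 hx]
  have hint (i : ℤ) : IntegrableOn (fun x => φ x * pc Δx a x) (I i) := by
    refine IntegrableOn.congr_fun ?_ (heq i) (hIm i)
    exact ((hφ.continuous.mul continuous_const).continuousOn.integrableOn_Icc).mono_set
      Set.Ico_subset_Icc_self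
  have hvol (i : ℤ) : volume.real (I i) = Δx := by
    rw [hI, Real.volume_real_Ico_of_le (by nlinarith)]
    ring
  have hbound (i : ℤ) : ‖∫ x in I i, ‖φ x * pc Δx a x‖‖ ≤
      (|φ 0| + Δx) * Δx * |a i| + Δx ^ 2 * (|(i : ℝ)| * |a i|) := by
    have : ∀ x ∈ I i, ‖‖φ x * pc Δx a x‖‖ ≤ (|φ 0| + (|(i : ℝ)| + 1) * Δx) * |a i| := by
      intro x hx
      rw [norm_norm, ← show φ x * a i = φ x * pc Δx a x from heq i hx, norm_mul, Real.norm_eq_abs, Real.norm_eq_abs]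
      refine mul_le_mul_of_nonneg_right ?_ (abs_nonneg _)
      have h1 : |φ x - φ 0| ≤ |x| := by simpa [Real.dist_eq] using hφ.dist_le_mul x 0
      have h2 : |φ x| ≤ |φ 0| + |φ x - φ 0| := by simpa using abs_add_le (φ 0) (φ x - φ 0)
      have h3 : |x| ≤ (|(i : ℝ)| + 1) * Δx := by
        rw [abs_le]
        have := mul_le_mul_of_nonneg_right (neg_abs_le (i : ℝ)) hΔx.le
        have := mul_le_mul_of_nonneg_right (le_abs_self (i : ℝ)) hΔx.le
        constructor <;> nlinarith [hx.1, hx.2]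
      linarith
    refine (norm_setIntegral_le_of_norm_le_const measure_Ico_lt_top this).trans_eq ?_
    rw [hvol]
    ring
  have hInt : IntegrableOn (fun x => φ x * pc Δx a x) (⋃ i, I i) :=
    integrableOn_iUnion_of_summable_integral_norm hint
      (Summable.of_norm_bounded ((ha.abs.mul_left _).add (hm.mul_left _)) hbound)
  rw [← setIntegral_univ, ← hU, integral_iUnion hIm hd hInt]
  refine tsum_congr fun i => ?_
  rw [← setIntegral_congr_fun (hIm i) (heq i), integral_mul_const, hI, integral_Ico_eq_integral_Ioc,
    ← intervalIntegral.integral_of_le (by nlinarith)]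

lemma integral_pc (hΔx : 0 < Δx) {a : ℤ → ℝ}
    (ha : Summable a) (hm : Summable fun i : ℤ => |(i : ℝ)| * |a i|) :
    ∫ x, pc Δx a x = Δx * ∑' i, a i := by
  have := integral_mul_pc hΔx ((LipschitzWith.const (1 : ℝ)).weaken zero_le_one) ha hm
  simp only [one_mul, intervalIntegral.integral_const, smul_eq_mul, mul_one] at this
  rw [this, ← tsum_mul_left]
  refine tsum_congr fun i => ?_
  ring

lemma integral_Iic_pc (hΔx : 0 < Δx) {a : ℤ → ℝ}
    (ha : Summable a) (hm : Summable fun i : ℤ => |(i : ℝ)| * |a i|) (n : ℤ) :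
    ∫ x in Set.Iic (((n : ℝ) + 1 / 2) * Δx), pc Δx a x =
      Δx * ∑' i, if i ≤ n then a i else 0 := by
  rw [← integral_pc hΔx (a := fun i => if i ≤ n then a i else 0) (summable_ite_le ha n)
    ((summable_ite_le hm n).congr fun i => ?_), integral_Iic_eq_integral_Iio,
    ← integral_indicator measurableSet_Iio]
  · congr 1 with x
    have : x < ((n : ℝ) + 1 / 2) * Δx ↔ ⌊x / Δx + 1 / 2⌋ ≤ n := by
      rw [← Int.lt_add_one_iff, Int.floor_lt, ← div_lt_iff₀ hΔx]
      push_cast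
      constructor <;> intro h <;> linarith
    simp only [Set.indicator, Set.mem_Iio, pc, this]
  · by_cases h : i ≤ n <;> simp [h]

lemma abs_cellAverage_sub_le (hΔx : 0 < Δx) {φ : ℝ → ℝ} (hφ : LipschitzWith 1 φ) (i : ℤ) :
    |(∫ x in ((((i + 1 : ℤ) : ℝ) - 1 / 2) * Δx)..((((i + 1 : ℤ) : ℝ) + 1 / 2) * Δx), φ x) / Δx -
      (∫ x in (((i : ℝ) - 1 / 2) * Δx)..(((i : ℝ) + 1 / 2) * Δx), φ x) / Δx| ≤ Δx := by
  have e1 : (((i + 1 : ℤ) : ℝ) - 1 / 2) * Δx = ((i : ℝ) - 1 / 2) * Δx + Δx := by push_cast; ring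
  have e2 : (((i + 1 : ℤ) : ℝ) + 1 / 2) * Δx = ((i : ℝ) + 1 / 2) * Δx + Δx := by push_cast; ring
  have hc := hφ.continuous
  rw [e1, e2, ← intervalIntegral.integral_comp_add_right, ← sub_div,
    ← intervalIntegral.integral_sub
      (Continuous.intervalIntegrable (by fun_prop) _ _) (hc.intervalIntegrable _ _),
    abs_div, abs_of_pos hΔx, div_le_iff₀ hΔx, ← Real.norm_eq_abs]
  refine (intervalIntegral.norm_integral_le_of_norm_le_const (C := Δx) fun x _ => ?_).trans_eq ?_
  · simpa [Real.dist_eq, abs_of_pos hΔx] using hφ.dist_le_mul (x + Δx) x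
  · rw [show ((i : ℝ) + 1 / 2) * Δx - ((i : ℝ) - 1 / 2) * Δx = Δx by ring, abs_of_pos hΔx]

end Cells

lemma W1_comm (u v : ℝ → ℝ) : W1 u v = W1 v u := by
  suffices h : ∀ u v : ℝ → ℝ, {r : ℝ | ∃ φ : ℝ → ℝ, LipschitzWith 1 φ ∧
      r = ∫ x : ℝ, φ x * (u x - v x)} ⊆ {r : ℝ | ∃ φ : ℝ → ℝ, LipschitzWith 1 φ ∧
      r = ∫ x : ℝ, φ x * (v x - u x)} from
    congrArg sSup ((h u v).antisymm (h v u))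
  rintro u v _ ⟨φ, hφ, rfl⟩
  refine ⟨fun x => -φ x, hφ.neg, ?_⟩
  congr 1 with x
  ring

lemma W1D_comm (Δx : ℝ) (u v : ℤ → ℝ) : W1D Δx u v = W1D Δx v u := by
  suffices h : ∀ u v : ℤ → ℝ, {r : ℝ | ∃ φ : ℤ → ℝ, (∀ i, |φ (i + 1) - φ i| ≤ Δx) ∧
      r = ∑' i : ℤ, φ i * (u i - v i) * Δx} ⊆ {r : ℝ | ∃ φ : ℤ → ℝ,
      (∀ i, |φ (i + 1) - φ i| ≤ Δx) ∧ r = ∑' i : ℤ, φ i * (v i - u i) * Δx} from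
    congrArg sSup ((h u v).antisymm (h v u))
  rintro u v _ ⟨φ, hφ, rfl⟩
  refine ⟨fun i => -φ i, fun i => ?_, tsum_congr fun i => by ring⟩
  rw [neg_sub_neg, abs_sub_comm]
  exact hφ i

lemma wasserstein_eq_discrete_wasserstein_of_nonneg_primitive
    {Δx : ℝ} (hΔx : 0 < Δx) {u v : ℤ → ℝ}
    (hsum : Summable (fun i : ℤ => u i - v i))
    (hzero : (∑' i : ℤ, (u i - v i)) = 0)
    (hmom : Summable (fun i : ℤ => |(i : ℝ)| * |u i - v i|))
    (hsign : ∀ x : ℝ, 0 ≤ ∫ y in Set.Iic x, (pc Δx u y - pc Δx v y)) :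
    W1 (pc Δx u) (pc Δx v) = W1D Δx u v := by
  set w : ℤ → ℝ := fun i => u i - v i
  have hF (n : ℤ) : 0 ≤ ∑' i, if i ≤ n then w i else 0 := by
    have h := (hsign (((n : ℝ) + 1 / 2) * Δx)).trans_eq (integral_Iic_pc hΔx hsum hmom n)
    exact nonneg_of_mul_nonneg_right h hΔx
  have hval {φ : ℝ → ℝ} (hφ : LipschitzWith 1 φ) :
      ∫ x : ℝ, φ x * (pc Δx u x - pc Δx v x) =
        ∑' i : ℤ, (∫ x in (((i : ℝ) - 1 / 2) * Δx)..(((i : ℝ) + 1 / 2) * Δx), φ x) * w i :=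
    integral_mul_pc hΔx hφ hsum hmom
  set M : ℝ := ∑' i : ℤ, (-(i * Δx)) * w i * Δx with hM
  have hlin (i : ℤ) : |-(((i + 1 : ℤ) : ℝ) * Δx) - -((i : ℝ) * Δx)| ≤ Δx := by
    push_cast
    rw [show -(((i : ℝ) + 1) * Δx) - -((i : ℝ) * Δx) = -Δx by ring, abs_neg, abs_of_pos hΔx]
  have hupper : ∀ φ : ℤ → ℝ, (∀ i, |φ (i + 1) - φ i| ≤ Δx) →
      ∑' i : ℤ, φ i * w i * Δx ≤ M := by
    intro φ hφ
    have s1 := (summable_mul_of_abs_sub_le hsum hmom hφ).mul_right Δx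
    have s2 := (summable_mul_of_abs_sub_le (Φ := fun i => -(i * Δx)) hsum hmom hlin).mul_right Δx
    rw [hM, ← sub_nonpos, ← s1.tsum_sub s2]
    have hstep (i : ℤ) : 0 ≤ (φ (i + 1) + ((i + 1 : ℤ) : ℝ) * Δx) - (φ i + i * Δx) ∧
        (φ (i + 1) + ((i + 1 : ℤ) : ℝ) * Δx) - (φ i + i * Δx) ≤ 2 * Δx := by
      have := abs_le.1 (hφ i)
      push_cast
      constructor <;> linarith
    have key := tsum_mul_nonpos_of_monotone (Φ := fun i => φ i + i * Δx) (C := 2 * Δx)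
      hsum hzero hmom hF (by positivity) (fun i => sub_nonneg.1 (hstep i).1)
      (fun i => by rw [abs_of_nonneg (hstep i).1]; exact (hstep i).2)
    calc ∑' i : ℤ, (φ i * w i * Δx - -(i * Δx) * w i * Δx)
        = (∑' i : ℤ, (φ i + i * Δx) * w i) * Δx := by
          rw [← tsum_mul_right]
          exact tsum_congr fun i => by ring
      _ ≤ 0 := mul_nonpos_of_nonpos_of_nonneg key hΔx.le
  have gD : IsGreatest {r : ℝ | ∃ φ : ℤ → ℝ, (∀ i, |φ (i + 1) - φ i| ≤ Δx) ∧
      r = ∑' i : ℤ, φ i * (u i - v i) * Δx} M := by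
    refine ⟨⟨fun i => -(i * Δx), hlin, rfl⟩, ?_⟩
    rintro _ ⟨φ, hφ, rfl⟩
    exact hupper φ hφ
  have gC : IsGreatest {r : ℝ | ∃ φ : ℝ → ℝ, LipschitzWith 1 φ ∧
      r = ∫ x : ℝ, φ x * (pc Δx u x - pc Δx v x)} M := by
    refine ⟨⟨fun x => -x, LipschitzWith.id.neg, ?_⟩, ?_⟩
    · rw [hval (φ := fun x => -x) LipschitzWith.id.neg, hM]
      refine tsum_congr fun i => ?_
      rw [intervalIntegral.integral_neg, integral_id]
      ring
    · rintro _ ⟨φ, hφ, rfl⟩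
      rw [hval hφ]
      refine le_of_eq_of_le (tsum_congr fun i => ?_)
        (hupper (fun i => (∫ x in (((i : ℝ) - 1 / 2) * Δx)..(((i : ℝ) + 1 / 2) * Δx), φ x) / Δx)
          (abs_cellAverage_sub_le hΔx hφ))
      field_simp
  rw [W1, W1D, gC.csSup_eq, gD.csSup_eq]

/-- If the primitive of `u_{Δx} - v_{Δx}` has a fixed sign, then the Wasserstein distance
between the piecewise constant grid functions equals their discrete Wasserstein distance. -/
theorem wasserstein_eq_discrete_wasserstein_of_signed_primitive
    (Δx : ℝ) (hΔx : 0 < Δx) (u v : ℤ → ℝ)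
    (hsum : Summable (fun i : ℤ => u i - v i))
    (hzero : (∑' i : ℤ, (u i - v i)) = 0)
    (hmom : Summable (fun i : ℤ => |(i : ℝ)| * |u i - v i|))
    (hsign : (∀ x : ℝ, 0 ≤ ∫ y in Set.Iic x, (pc Δx u y - pc Δx v y)) ∨
             (∀ x : ℝ, (∫ y in Set.Iic x, (pc Δx u y - pc Δx v y)) ≤ 0)) :
    W1 (pc Δx u) (pc Δx v) = W1D Δx u v := by
  rcases hsign with h | h
  · exact wasserstein_eq_discrete_wasserstein_of_nonneg_primitive hΔx hsum hzero hmom h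
  · rw [W1_comm, W1D_comm]
    refine wasserstein_eq_discrete_wasserstein_of_nonneg_primitive hΔx ?_ ?_ ?_ fun x => ?_
    · simpa using hsum.neg
    · rw [← neg_eq_zero, ← tsum_neg]
      simpa using hzero
    · simpa only [abs_sub_comm] using hmom
    · have := neg_nonneg.2 (h x)
      rw [← integral_neg] at this
      simpa using this
end

section
/- Let Δx, Δt > 0 with λ = Δt/Δx, and let real numbers A_i^n, B_i^n (i ∈ ℤ, n ∈ ℕ) satisfy 0 ≤ A_i^n ≤ A_{i−1}^n, 0 ≥ B_{i−1}^n ≥ B_i^n, and λ(A_{i−1}^n − B_i^n) ≤ 1 for all i and n. If grid functions φ^n = (φ_i^n)_{i∈ℤ} satisfy the backward difference equation (φ_i^{n+1} − φ_i^n)/Δt + (1/Δx)( A_i^n (φ_{i+1}^{n+1} − φ_i^{n+1}) + B_i^n (φ_i^{n+1} − φ_{i−1}^{n+1}) ) = 0 for all i and n, then ‖φ^n‖_DLip ≤ ‖φ^{n+1}‖_DLip for all n. -/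
open scoped ENNReal

/-- The discrete Lipschitz seminorm `‖φ‖_DLip = sup_i |φ_{i+1} - φ_i| / Δx`
(valued in `ℝ≥0∞`, so that the supremum always exists). -/
noncomputable def DLipNorm (Δx : ℝ) (φ : ℤ → ℝ) : ℝ≥0∞ :=
  ⨆ i : ℤ, ENNReal.ofReal (|φ (i + 1) - φ i| / Δx)

theorem DLipNorm_le_ofReal_iff {Δx : ℝ} (hΔx : 0 < Δx) {φ : ℤ → ℝ} {M : ℝ} (hM : 0 ≤ M) :
    DLipNorm Δx φ ≤ ENNReal.ofReal M ↔ ∀ i, |φ (i + 1) - φ i| ≤ M * Δx := by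
  simp only [DLipNorm, iSup_le_iff, ENNReal.ofReal_le_ofReal_iff hM, div_le_iff₀ hΔx]

theorem abs_subconvex_combination_le {a b c x y z K : ℝ} (ha : 0 ≤ a) (hb : 0 ≤ b) (hc : 0 ≤ c)
    (habc : a + b + c ≤ 1) (hx : |x| ≤ K) (hy : |y| ≤ K) (hz : |z| ≤ K) :
    |a * x + b * y + c * z| ≤ K := by
  have hK : 0 ≤ K := (abs_nonneg x).trans hx
  calc |a * x + b * y + c * z| ≤ |a * x| + |b * y| + |c * z| := abs_add_three _ _ _
    _ = a * |x| + b * |y| + c * |z| := by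
      rw [abs_mul, abs_mul, abs_mul, abs_of_nonneg ha, abs_of_nonneg hb, abs_of_nonneg hc]
    _ ≤ a * K + b * K + c * K := by gcongr
    _ = (a + b + c) * K := by ring
    _ ≤ K := mul_le_of_le_one_left hK habc

/-- Stability of the discrete backward dual problem: under the monotonicity and CFL
conditions on the coefficients `A`, `B`, the discrete Lipschitz seminorm of the solution
of the backward difference equation does not increase backwards in time. -/
theorem backward_dual_DLip_stability
    (Δx Δt : ℝ) (hΔx : 0 < Δx) (hΔt : 0 < Δt)
    (A B : ℤ → ℕ → ℝ) (φ : ℤ → ℕ → ℝ)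
    (hA0 : ∀ i n, 0 ≤ A i n)
    (hA1 : ∀ i n, A i n ≤ A (i - 1) n)
    (hB0 : ∀ i n, B (i - 1) n ≤ 0)
    (hB1 : ∀ i n, B i n ≤ B (i - 1) n)
    (hCFL : ∀ i n, (Δt / Δx) * (A (i - 1) n - B i n) ≤ 1)
    (hscheme : ∀ i n, (φ i (n + 1) - φ i n) / Δt +
      (1 / Δx) * (A i n * (φ (i + 1) (n + 1) - φ i (n + 1)) +
                  B i n * (φ i (n + 1) - φ (i - 1) (n + 1))) = 0) :
    ∀ n : ℕ, DLipNorm Δx (fun i => φ i n) ≤ DLipNorm Δx (fun i => φ i (n + 1)) := by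
  intro n
  rcases eq_or_ne (DLipNorm Δx (fun i => φ i (n + 1))) ⊤ with htop | htop
  · exact htop ▸ le_top
  have hM : 0 ≤ (DLipNorm Δx (fun i => φ i (n + 1))).toReal := ENNReal.toReal_nonneg
  have hbound := (DLipNorm_le_ofReal_iff hΔx hM).1 (ENNReal.ofReal_toReal htop).ge
  rw [← ENNReal.ofReal_toReal htop, DLipNorm_le_ofReal_iff hΔx hM]
  intro i
  have hstep (j : ℤ) : φ j n = φ j (n + 1) +
      Δt / Δx * (A j n * (φ (j + 1) (n + 1) - φ j (n + 1)) +
        B j n * (φ j (n + 1) - φ (j - 1) (n + 1))) := by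
    have h := hscheme j n
    field_simp at h ⊢
    linarith
  have hlam : 0 ≤ Δt / Δx := (div_pos hΔt hΔx).le
  have hA := hA1 (i + 1) n
  have hB := hB1 (i + 1) n
  have hBi := hB0 (i + 1) n
  have hC := hCFL (i + 1) n
  have hprev := hbound (i - 1)
  simp only [add_sub_cancel_right, sub_add_cancel] at hA hB hBi hC hprev
  have hdiff : φ (i + 1) n - φ i n =
      Δt / Δx * A (i + 1) n * (φ (i + 1 + 1) (n + 1) - φ (i + 1) (n + 1)) +
      (1 - Δt / Δx * (A i n - B (i + 1) n)) * (φ (i + 1) (n + 1) - φ i (n + 1)) +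
      Δt / Δx * -B i n * (φ i (n + 1) - φ (i - 1) (n + 1)) := by
    rw [hstep (i + 1), hstep i, add_sub_cancel_right]
    ring
  rw [hdiff]
  refine abs_subconvex_combination_le (mul_nonneg hlam (hA0 _ _)) (sub_nonneg.2 hC)
    (mul_nonneg hlam (neg_nonneg.2 hBi)) ?_ (hbound (i + 1)) (hbound i) hprev
  have hAle := mul_le_mul_of_nonneg_left hA hlam
  have hBle := mul_le_mul_of_nonneg_left hB hlam
  linarith
end

section
/- Let u₀, v₀ ∈ L^∞(ℝ) be decreasing functions whose difference u₀ − v₀ satisfies ∫_ℝ (u₀−v₀) dx = 0 and ∫_ℝ |x||u₀−v₀| dx < ∞. Let (u_i^n) and (v_i^n) be computed by the monotone inhomogeneous schemes u_i^{n+1} = u_i^n − λ(F(u_i^n,u_{i+1}^n) − F(u_{i−1}^n,u_i^n)) + h_i^n Δt and v_i^{n+1} = v_i^n − λ(F(v_i^n,v_{i+1}^n) − F(v_{i−1}^n,v_i^n)) + g_i^n Δt, initialized by cell averages of u₀ and v₀, where h^n − g^n has zero sum and finite first moment for every n. Assume that for every i and n one can write F(u_i^n, u_{i+1}^n) − F(v_i^n,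 v_{i+1}^n) = A_i^n (u_i^n − v_i^n) + B_{i+1}^n (u_{i+1}^n − v_{i+1}^n), where the coefficients satisfy 0 ≤ A_i^n ≤ A_{i−1}^n, 0 ≥ B_{i−1}^n ≥ B_i^n, and λ(A_{i−1}^n − B_i^n) ≤ 1, and assume the CFL condition holds. Then W₁(u_{Δx}(·,t^N), v_{Δx}(·,t^N)) ≤ W_{1,D}(u_{Δx}(·,0), v_{Δx}(·,0)) + Δt Σ_{n=0}^{N−1} W_{1,D}(h^n, g^n) for all N ∈ ℕ; i.e., the scheme is W₁-contractive. -/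
open MeasureTheory

/-- The cell average `(1/Δx) ∫_{I_i} u₀` on `I_i = [(i - 1/2)Δx, (i + 1/2)Δx)`. -/
noncomputable def cellAvg (Δx : ℝ) (u₀ : ℝ → ℝ) (i : ℤ) : ℝ :=
  (1 / Δx) * ∫ x in Set.Ico (((i : ℝ) - 1 / 2) * Δx) (((i : ℝ) + 1 / 2) * Δx), u₀ x

/-- A grid function is summable together with its first moment. -/
def SummableMoment (e : ℤ → ℝ) : Prop :=
  Summable fun i : ℤ => (1 + |(i : ℝ)|) * |e i|

/-- A discrete test function whose increments are bounded by `Δx`. -/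
def IsGridLipschitz (Δx : ℝ) (φ : ℤ → ℝ) : Prop :=
  ∀ i, |φ (i + 1) - φ i| ≤ Δx

namespace SummableMoment

variable {e e' : ℤ → ℝ}

theorem summable (he : SummableMoment e) : Summable e := by
  refine Summable.of_norm_bounded he fun i => ?_
  rw [Real.norm_eq_abs]
  nlinarith [abs_nonneg (i : ℝ), abs_nonneg (e i)]

theorem add (he : SummableMoment e) (he' : SummableMoment e') :
    SummableMoment fun i => e i + e' i := by
  refine Summable.of_nonneg_of_le (fun i => by positivity) (fun i => ?_) (Summable.add he he')
  rw [← mul_add]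
  gcongr
  exact abs_add_le _ _

theorem bounded_mul (he : SummableMoment e) {c : ℤ → ℝ} {C : ℝ} (hc : ∀ i, |c i| ≤ C) :
    SummableMoment fun i => c i * e i := by
  refine Summable.of_nonneg_of_le (fun i => by positivity) (fun i => ?_) (Summable.mul_left C he)
  rw [abs_mul]
  calc (1 + |(i : ℝ)|) * (|c i| * |e i|) = |c i| * ((1 + |(i : ℝ)|) * |e i|) := by ring
    _ ≤ C * ((1 + |(i : ℝ)|) * |e i|) := by gcongr; exact hc i

theorem shift (he : SummableMoment e) (k : ℤ) : SummableMoment fun i => e (i + k) := by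
  have h := (Equiv.addRight k).summable_iff.mpr he
  refine Summable.of_nonneg_of_le (fun i => by positivity) (fun i => ?_)
    (h.mul_left (1 + |(k : ℝ)|))
  simp only [Function.comp, Equiv.coe_addRight, Int.cast_add]
  have h1 : |(i : ℝ)| ≤ |(i : ℝ) + k| + |(k : ℝ)| := by
    simpa using abs_sub ((i : ℝ) + k) k
  rw [← mul_assoc]
  gcongr
  nlinarith [abs_nonneg (k : ℝ), abs_nonneg ((i : ℝ) + k)]

end SummableMoment

namespace IsGridLipschitz

variable {Δx : ℝ} {φ e : ℤ → ℝ}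

theorem abs_sub_zero_le (hφ : IsGridLipschitz Δx φ) (i : ℤ) :
    |φ i - φ 0| ≤ Δx * |(i : ℝ)| := by
  induction i using Int.induction_on with
  | zero => simp
  | succ k ih =>
    have h := hφ k
    have h2 := abs_sub_le (φ (k + 1)) (φ k) (φ 0)
    have h3 : |(((k : ℤ) + 1 : ℤ) : ℝ)| = k + 1 := by
      push_cast; exact abs_of_nonneg (by positivity)
    have h4 : |((k : ℤ) : ℝ)| = k := by simp
    rw [h3]; rw [h4] at ih
    linarith
  | pred k ih =>
    have h := hφ (-k - 1)
    have h2 := abs_sub_le (φ (-k - 1)) (φ (-k)) (φ 0)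
    have h3 : |((-(k : ℤ) - 1 : ℤ) : ℝ)| = k + 1 := by
      push_cast
      rw [abs_of_nonpos (by linarith [(Nat.cast_nonneg k : (0 : ℝ) ≤ k)])]
      ring
    have h4 : |((-(k : ℤ) : ℤ) : ℝ)| = k := by simp
    rw [sub_add_cancel, abs_sub_comm] at h
    rw [h3]; rw [h4] at ih
    linarith

theorem nonneg (hφ : IsGridLipschitz Δx φ) : 0 ≤ Δx := (abs_nonneg _).trans (hφ 0)

theorem summable_mul (hφ : IsGridLipschitz Δx φ) (he : SummableMoment e) :
    Summable fun i => φ i * e i := by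
  refine Summable.of_norm_bounded (Summable.mul_left (|φ 0| + Δx) he) fun i => ?_
  rw [Real.norm_eq_abs, abs_mul, ← mul_assoc]
  have h1 := hφ.abs_sub_zero_le i
  have h2 : |φ i| ≤ |φ i - φ 0| + |φ 0| := by
    simpa using abs_add_le (φ i - φ 0) (φ 0)
  gcongr
  nlinarith [abs_nonneg (i : ℝ), abs_nonneg (φ 0), hφ.nonneg]

theorem tsum_mul_le (hφ : IsGridLipschitz Δx φ) (he : SummableMoment e) (h0 : ∑' i, e i = 0) :
    ∑' i, φ i * e i ≤ Δx * ∑' i : ℤ, (1 + |(i : ℝ)|) * |e i| := by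
  have h1 : ∑' i, φ i * e i = ∑' i, (φ i * e i - φ 0 * e i) := by
    rw [(hφ.summable_mul he).tsum_sub (he.summable.mul_left _), tsum_mul_left, h0]
    simp
  rw [h1, ← tsum_mul_left]
  refine ((hφ.summable_mul he).sub (he.summable.mul_left _)).tsum_le_tsum (fun i => ?_)
    (Summable.mul_left Δx he)
  rw [← sub_mul]
  refine (le_abs_self _).trans ?_
  rw [abs_mul, ← mul_assoc]
  gcongr
  nlinarith [hφ.abs_sub_zero_le i, hφ.nonneg]

end IsGridLipschitz

theorem IsGridLipschitz.le_W1D {Δx : ℝ} {φ u v : ℤ → ℝ} (hφ : IsGridLipschitz Δx φ)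
    (he : SummableMoment fun i => u i - v i) (h0 : ∑' i, (u i - v i) = 0) :
    (∑' i, φ i * (u i - v i)) * Δx ≤ W1D Δx u v := by
  refine le_csSup ⟨Δx * (∑' i : ℤ, (1 + |(i : ℝ)|) * |u i - v i|) * Δx, ?_⟩ ⟨φ, hφ, ?_⟩
  · rintro r ⟨ψ, hψ, rfl⟩
    rw [tsum_mul_right]
    exact mul_le_mul_of_nonneg_right (IsGridLipschitz.tsum_mul_le hψ he h0) hφ.nonneg
  · rw [tsum_mul_right]

theorem W1D_nonneg {Δx : ℝ} (hΔx : 0 ≤ Δx) {u v : ℤ → ℝ}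
    (he : SummableMoment fun i => u i - v i) (h0 : ∑' i, (u i - v i) = 0) :
    0 ≤ W1D Δx u v := by
  have hφ : IsGridLipschitz Δx fun _ => 0 := fun i => by simpa using hΔx
  simpa using hφ.le_W1D he h0

/-- Coefficients of a conservative three-point update that is nonexpansive in the discrete
Wasserstein distance. -/
structure IsContractiveStencil (a b : ℤ → ℝ) : Prop where
  left_nonneg : ∀ i, 0 ≤ a i
  right_nonneg : ∀ i, 0 ≤ b i
  left_anti : ∀ i, a (i + 1) ≤ a i
  right_mono : ∀ i, b i ≤ b (i + 1)
  add_le_one : ∀ i, a i + b (i + 1) ≤ 1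

/-- The three-point update moving the fraction `a i` to the right and `b i` to the left. -/
def stencil (a b e : ℤ → ℝ) (i : ℤ) : ℝ :=
  (1 - a i - b i) * e i + a (i - 1) * e (i - 1) + b (i + 1) * e (i + 1)

/-- The transpose of `stencil`. -/
def dualStencil (a b φ : ℤ → ℝ) (i : ℤ) : ℝ :=
  (1 - a i - b i) * φ i + a i * φ (i + 1) + b i * φ (i - 1)

namespace IsContractiveStencil

variable {a b e φ : ℤ → ℝ} {Δx : ℝ}

theorem abs_left_le (h : IsContractiveStencil a b) (i : ℤ) : |a i| ≤ 1 := by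
  rw [abs_of_nonneg (h.left_nonneg i)]
  linarith [h.add_le_one i, h.right_nonneg (i + 1)]

theorem abs_right_le (h : IsContractiveStencil a b) (i : ℤ) : |b i| ≤ 1 := by
  rw [abs_of_nonneg (h.right_nonneg i)]
  have := h.add_le_one (i - 1)
  rw [sub_add_cancel] at this
  linarith [h.left_nonneg (i - 1)]

theorem abs_diag_le (h : IsContractiveStencil a b) (i : ℤ) : |1 - a i - b i| ≤ 1 := by
  rw [abs_le]
  constructor <;>
  linarith [h.left_nonneg i, h.right_nonneg i, abs_le.1 (h.abs_left_le i),
    abs_le.1 (h.abs_right_le i)]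

theorem dualStencil_lipschitz (h : IsContractiveStencil a b) (hφ : IsGridLipschitz Δx φ) :
    IsGridLipschitz Δx (dualStencil a b φ) := by
  intro i
  have h0 := hφ (i - 1)
  have h1 := hφ i
  have h2 := hφ (i + 1)
  have e1 := h.left_nonneg (i + 1)
  have e2 := h.right_nonneg i
  have e3 := h.add_le_one i
  have e4 := h.left_anti i
  have e5 := h.right_mono i
  have hΔ := hφ.nonneg
  rw [sub_add_cancel] at h0
  have key : dualStencil a b φ (i + 1) - dualStencil a b φ i =
      (1 - a i - b (i + 1)) * (φ (i + 1) - φ i) + a (i + 1) * (φ (i + 1 + 1) - φ (i + 1)) +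
        b i * (φ i - φ (i - 1)) := by
    simp only [dualStencil, add_sub_cancel_right]
    ring
  rw [key]
  refine (abs_add_three _ _ _).trans ?_
  rw [abs_mul, abs_mul, abs_mul, abs_of_nonneg e1, abs_of_nonneg e2,
    abs_of_nonneg (by linarith : 0 ≤ 1 - a i - b (i + 1))]
  calc _ ≤ (1 - a i - b (i + 1)) * Δx + a (i + 1) * Δx + b i * Δx := by
        gcongr
        linarith
    _ ≤ Δx := by nlinarith

theorem summableMoment (h : IsContractiveStencil a b) (he : SummableMoment e) :
    SummableMoment (stencil a b e) :=
  ((he.bounded_mul h.abs_diag_le).add ((he.bounded_mul h.abs_left_le).shift (-1))).add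
    ((he.bounded_mul h.abs_right_le).shift 1)

theorem tsum_mul_stencil (h : IsContractiveStencil a b) (he : SummableMoment e)
    (hφ : IsGridLipschitz Δx φ) :
    ∑' i, φ i * stencil a b e i = ∑' i, dualStencil a b φ i * e i := by
  have d0 := he.bounded_mul h.abs_diag_le
  have d1 := he.bounded_mul h.abs_left_le
  have d2 := he.bounded_mul h.abs_right_le
  have s0 := hφ.summable_mul d0
  have s1 := hφ.summable_mul (d1.shift (-1))
  have s2 := hφ.summable_mul (d2.shift 1)
  have t1 := (Equiv.addRight (1 : ℤ)).summable_iff.mpr s1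
  have t2 := (Equiv.addRight (-1 : ℤ)).summable_iff.mpr s2
  have q1 := (Equiv.addRight (1 : ℤ)).tsum_eq fun i => φ i * (a (i + -1) * e (i + -1))
  have q2 := (Equiv.addRight (-1 : ℤ)).tsum_eq fun i => φ i * (b (i + 1) * e (i + 1))
  simp only [Function.comp_def, Equiv.coe_addRight, add_neg_cancel_right,
    neg_add_cancel_right] at t1 t2 q1 q2
  calc ∑' i, φ i * stencil a b e i
      = ∑' i, (φ i * ((1 - a i - b i) * e i) + φ i * (a (i + -1) * e (i + -1)) +
          φ i * (b (i + 1) * e (i + 1))) := by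
        congr 1 with i
        simp only [stencil, ← sub_eq_add_neg]
        ring
    _ = ∑' i, dualStencil a b φ i * e i := by
        rw [(s0.add s1).tsum_add s2, s0.tsum_add s1, ← q1, ← q2, ← s0.tsum_add t1,
          ← (s0.add t1).tsum_add t2]
        congr 1 with i
        simp only [dualStencil, ← sub_eq_add_neg]
        ring

theorem tsum_stencil (h : IsContractiveStencil a b) (he : SummableMoment e) :
    ∑' i, stencil a b e i = ∑' i, e i := by
  have hφ : IsGridLipschitz 0 fun _ => 1 := fun i => by simp
  have key := h.tsum_mul_stencil he hφ
  have h1 (i : ℤ) : dualStencil a b (fun _ => 1) i = 1 := by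
    simp only [dualStencil]
    ring
  simpa [h1] using key

end IsContractiveStencil

theorem W1D_stencil_le {a b u v u' v' h g : ℤ → ℝ} {Δx Δt : ℝ} (hΔx : 0 ≤ Δx) (hΔt : 0 ≤ Δt)
    (hab : IsContractiveStencil a b)
    (he : SummableMoment fun i => u i - v i) (he0 : ∑' i, (u i - v i) = 0)
    (hs : SummableMoment fun i => h i - g i) (hs0 : ∑' i, (h i - g i) = 0)
    (hstep : ∀ i, u' i - v' i = stencil a b (fun i => u i - v i) i + Δt * (h i - g i)) :
    W1D Δx u' v' ≤ W1D Δx u v + Δt * W1D Δx h g := by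
  refine csSup_le ⟨_, fun _ => 0, fun i => by simpa using hΔx, rfl⟩ ?_
  rintro r ⟨φ, hφ, rfl⟩
  replace hφ : IsGridLipschitz Δx φ := hφ
  have s1 := hφ.summable_mul (hab.summableMoment he)
  have s2 := (hφ.summable_mul hs).mul_left Δt
  have key : ∑' i, φ i * (u' i - v' i) =
      ∑' i, dualStencil a b φ i * (u i - v i) + Δt * ∑' i, φ i * (h i - g i) := by
    rw [← hab.tsum_mul_stencil he hφ, ← tsum_mul_left, ← s1.tsum_add s2]
    congr 1 with i
    rw [hstep]
    ring
  rw [tsum_mul_right, key, add_mul, mul_assoc]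
  gcongr
  · exact (hab.dualStencil_lipschitz hφ).le_W1D he he0
  · exact hφ.le_W1D hs hs0

/-- The grid cell of index `i`. -/
def gridCell (Δx : ℝ) (i : ℤ) : Set ℝ :=
  Set.Ico (((i : ℝ) - 1 / 2) * Δx) (((i : ℝ) + 1 / 2) * Δx)

section gridCell

variable {Δx : ℝ}

theorem mem_gridCell_iff (hΔx : 0 < Δx) {i : ℤ} {x : ℝ} :
    x ∈ gridCell Δx i ↔ ⌊x / Δx + 1 / 2⌋ = i := by
  rw [gridCell, Set.mem_Ico, Int.floor_eq_iff, ← le_div_iff₀ hΔx, ← div_lt_iff₀ hΔx]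
  constructor <;> rintro ⟨h1, h2⟩ <;> constructor <;> linarith

theorem measurableSet_gridCell (i : ℤ) : MeasurableSet (gridCell Δx i) := measurableSet_Ico

theorem hasSum_integral_gridCell (hΔx : 0 < Δx) {f : ℝ → ℝ} (hf : Integrable f) :
    HasSum (fun i : ℤ => ∫ x in gridCell Δx i, f x) (∫ x, f x) := by
  have hU : ⋃ i : ℤ, gridCell Δx i = Set.univ :=
    Set.eq_univ_of_forall fun x => Set.mem_iUnion.2 ⟨_, (mem_gridCell_iff hΔx).2 rfl⟩
  have h := hasSum_integral_iUnion (μ := volume) (f := f) (s := gridCell Δx)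
    measurableSet_gridCell (fun i j hij => Set.disjoint_left.2 fun x hi hj =>
      hij (((mem_gridCell_iff hΔx).1 hi).symm.trans ((mem_gridCell_iff hΔx).1 hj)))
    (hf.integrableOn)
  rwa [hU, setIntegral_univ] at h

theorem volume_real_gridCell (hΔx : 0 < Δx) (i : ℤ) : volume.real (gridCell Δx i) = Δx := by
  rw [gridCell, Real.volume_real_Ico_of_le (by nlinarith)]
  ring

theorem Continuous.integrableOn_gridCell {f : ℝ → ℝ} (hf : Continuous f) (i : ℤ) :
    IntegrableOn f (gridCell Δx i) :=
  hf.integrableOn_Icc.mono_set Set.Ico_subset_Icc_self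

theorem Antitone.integrableOn_gridCell {f : ℝ → ℝ} (hf : Antitone f) (i : ℤ) :
    IntegrableOn f (gridCell Δx i) :=
  ((hf.antitoneOn _).integrableOn_isCompact isCompact_Icc).mono_set Set.Ico_subset_Icc_self

theorem setIntegral_gridCell_succ (f : ℝ → ℝ) (i : ℤ) :
    ∫ x in gridCell Δx (i + 1), f x = ∫ x in gridCell Δx i, f (x + Δx) := by
  have h := (measurePreserving_add_right (volume : Measure ℝ) Δx).setIntegral_preimage_emb
    (measurableEmbedding_addRight Δx) f (gridCell Δx (i + 1))
  rw [← h]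
  congr 2
  ext x
  simp only [gridCell, Set.mem_preimage, Set.mem_Ico]
  push_cast
  constructor <;> rintro ⟨h1, h2⟩ <;> constructor <;> linarith

theorem LipschitzWith.isGridLipschitz_average (hΔx : 0 < Δx) {φ : ℝ → ℝ} (hφ : LipschitzWith 1 φ) :
    IsGridLipschitz Δx fun i => (∫ x in gridCell Δx i, φ x) / Δx := by
  intro i
  have hc : Continuous fun x => φ (x + Δx) := hφ.continuous.comp (continuous_add_const Δx)
  rw [← sub_div, setIntegral_gridCell_succ,
    ← integral_sub (hc.integrableOn_gridCell i) (hφ.continuous.integrableOn_gridCell i),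
    abs_div, abs_of_pos hΔx, div_le_iff₀ hΔx]
  have h := norm_setIntegral_le_of_norm_le_const (μ := volume) (s := gridCell Δx i)
    (f := fun x => φ (x + Δx) - φ x) (C := Δx) measure_Ico_lt_top fun x _ => by
      have := hφ.dist_le_mul (x + Δx) x
      rw [Real.dist_eq, Real.dist_eq] at this
      simpa [abs_of_pos hΔx] using this
  rwa [volume_real_gridCell hΔx, Real.norm_eq_abs] at h

theorem integral_mul_pc_sub (hΔx : 0 < Δx) {φ : ℝ → ℝ} {u v : ℤ → ℝ}
    (hf : Integrable fun x => φ x * (pc Δx u x - pc Δx v x)) :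
    ∫ x, φ x * (pc Δx u x - pc Δx v x) =
      (∑' i, (∫ x in gridCell Δx i, φ x) / Δx * (u i - v i)) * Δx := by
  rw [← (hasSum_integral_gridCell hΔx hf).tsum_eq, ← tsum_mul_right]
  congr 1 with i
  rw [setIntegral_congr_fun (measurableSet_gridCell i) (g := fun x => φ x * (u i - v i))
    fun x hx => by simp only [pc, (mem_gridCell_iff hΔx).1 hx], integral_mul_const]
  field_simp

theorem W1_pc_le_W1D (hΔx : 0 < Δx) {u v : ℤ → ℝ}
    (he : SummableMoment fun i => u i - v i) (h0 : ∑' i, (u i - v i) = 0) :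
    W1 (pc Δx u) (pc Δx v) ≤ W1D Δx u v := by
  refine csSup_le ⟨_, fun _ => 0, LipschitzWith.const' 0, rfl⟩ ?_
  rintro r ⟨φ, hφ, rfl⟩
  by_cases hf : Integrable fun x => φ x * (pc Δx u x - pc Δx v x)
  · rw [integral_mul_pc_sub hΔx hf]
    exact (hφ.isGridLipschitz_average hΔx).le_W1D he h0
  · rw [integral_undef hf]
    exact W1D_nonneg hΔx.le he h0

variable {u₀ v₀ : ℝ → ℝ}

theorem cellAvg_sub_cellAvg (hu : Antitone u₀) (hv : Antitone v₀) (i : ℤ) :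
    cellAvg Δx u₀ i - cellAvg Δx v₀ i = (1 / Δx) * ∫ x in gridCell Δx i, (u₀ x - v₀ x) := by
  rw [integral_sub (hu.integrableOn_gridCell i) (hv.integrableOn_gridCell i), mul_sub]
  rfl

theorem tsum_cellAvg_sub (hΔx : 0 < Δx) (hu : Antitone u₀) (hv : Antitone v₀)
    (hint : Integrable fun x => u₀ x - v₀ x) (hzero : (∫ x, (u₀ x - v₀ x)) = 0) :
    ∑' i, (cellAvg Δx u₀ i - cellAvg Δx v₀ i) = 0 := by
  simp_rw [cellAvg_sub_cellAvg hu hv]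
  rw [tsum_mul_left, (hasSum_integral_gridCell hΔx hint).tsum_eq, hzero, mul_zero]

theorem summableMoment_cellAvg_sub (hΔx : 0 < Δx) (hu : Antitone u₀) (hv : Antitone v₀)
    (hint : Integrable fun x => u₀ x - v₀ x)
    (hmom : Integrable fun x => |x| * |u₀ x - v₀ x|) :
    SummableMoment fun i => cellAvg Δx u₀ i - cellAvg Δx v₀ i := by
  have hI : Integrable fun x => 3 / 2 * |u₀ x - v₀ x| + 1 / Δx * (|x| * |u₀ x - v₀ x|) :=
    (hint.abs.const_mul _).add (hmom.const_mul _)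
  refine Summable.of_nonneg_of_le (fun i => by positivity) (fun i => ?_)
    ((hasSum_integral_gridCell hΔx hI).summable.mul_left (1 / Δx))
  beta_reduce
  rw [cellAvg_sub_cellAvg hu hv, abs_mul, abs_of_pos (by positivity : 0 < 1 / Δx), mul_left_comm]
  gcongr
  calc (1 + |(i : ℝ)|) * |∫ x in gridCell Δx i, (u₀ x - v₀ x)|
      ≤ (1 + |(i : ℝ)|) * ∫ x in gridCell Δx i, |u₀ x - v₀ x| := by
        gcongr
        exact abs_integral_le_integral_abs
    _ = ∫ x in gridCell Δx i, (1 + |(i : ℝ)|) * |u₀ x - v₀ x| := (integral_const_mul _ _).symm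
    _ ≤ _ := by
        refine setIntegral_mono_on (hint.abs.const_mul _).integrableOn hI.integrableOn
          (measurableSet_gridCell i) fun x hx => ?_
        rw [← mul_assoc, ← add_mul]
        refine mul_le_mul_of_nonneg_right ?_ (abs_nonneg _)
        obtain ⟨h1, h2⟩ := hx
        rw [← le_div_iff₀ hΔx] at h1
        rw [← div_lt_iff₀ hΔx] at h2
        have h3 : 1 / Δx * |x| = |x / Δx| := by
          rw [abs_div, abs_of_pos hΔx]
          ring
        have h4 : |(i : ℝ) - x / Δx| ≤ 1 / 2 := abs_le.2 ⟨by linarith, by linarith⟩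
        have h5 := abs_add_le ((i : ℝ) - x / Δx) (x / Δx)
        rw [sub_add_cancel] at h5
        rw [h3]
        linarith

end gridCell

/-- `W₁`-contractivity of monotone schemes admitting a coefficient decomposition of the
flux differences satisfying the sign, monotonicity and CFL conditions: for two solutions
of the inhomogeneous scheme with decreasing initial data, the Wasserstein distance at time
`t^N` is bounded by the initial discrete Wasserstein distance plus the accumulated discrete
Wasserstein distance of the sources. -/
theorem W1_contractivity_of_monotone_scheme
    (Δx Δt : ℝ) (hΔx : 0 < Δx) (hΔt : 0 < Δt)
    (F : ℝ → ℝ → ℝ)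
    (hFmono₁ : ∀ b, Monotone fun a => F a b)
    (hFmono₂ : ∀ a, Antitone fun b => F a b)
    (hGmono : ∀ a c, Monotone fun b => b - (Δt / Δx) * (F b c - F a b))
    (u₀ v₀ : ℝ → ℝ)
    (hu₀dec : Antitone u₀) (hv₀dec : Antitone v₀)
    (hbdd : ∃ M : ℝ, ∀ x, |u₀ x| ≤ M ∧ |v₀ x| ≤ M)
    (hint : Integrable (fun x => u₀ x - v₀ x))
    (hzero : (∫ x : ℝ, (u₀ x - v₀ x)) = 0)
    (hmom : Integrable (fun x => |x| * |u₀ x - v₀ x|))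
    (u v h g : ℤ → ℕ → ℝ)
    (hu0 : ∀ i, u i 0 = cellAvg Δx u₀ i)
    (hv0 : ∀ i, v i 0 = cellAvg Δx v₀ i)
    (hsrc : ∀ n, Summable (fun i : ℤ => h i n - g i n) ∧
      (∑' i : ℤ, (h i n - g i n)) = 0 ∧
      Summable (fun i : ℤ => |(i : ℝ)| * |h i n - g i n|))
    (hu : ∀ i n, u i (n + 1) =
      u i n - (Δt / Δx) * (F (u i n) (u (i + 1) n) - F (u (i - 1) n) (u i n)) + h i n * Δt)
    (hv : ∀ i n, v i (n + 1) =
      v i n - (Δt / Δx) * (F (v i n) (v (i + 1) n) - F (v (i - 1) n) (v i n)) + g i n * Δt)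
    -- the flux-difference decomposition with coefficients `A`, `B`
    (A B : ℤ → ℕ → ℝ)
    (hdecomp : ∀ i n, F (u i n) (u (i + 1) n) - F (v i n) (v (i + 1) n) =
      A i n * (u i n - v i n) + B (i + 1) n * (u (i + 1) n - v (i + 1) n))
    (hA0 : ∀ i n, 0 ≤ A i n)
    (hA1 : ∀ i n, A i n ≤ A (i - 1) n)
    (hB0 : ∀ i n, B (i - 1) n ≤ 0)
    (hB1 : ∀ i n, B i n ≤ B (i - 1) n)
    (hABCFL : ∀ i n, (Δt / Δx) * (A (i - 1) n - B i n) ≤ 1)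
    -- the CFL condition, with Lipschitz constants of `F` over the range of the data
    (ulo uhi : ℝ) (hrange : ∀ i, u i 0 ∈ Set.Icc ulo uhi)
    (hCFL : ∃ La Lb : ℝ,
      (∀ a a' b, a ∈ Set.Icc ulo uhi → a' ∈ Set.Icc ulo uhi → b ∈ Set.Icc ulo uhi →
        |F a b - F a' b| ≤ La * |a - a'|) ∧
      (∀ a b b', a ∈ Set.Icc ulo uhi → b ∈ Set.Icc ulo uhi → b' ∈ Set.Icc ulo uhi →
        |F a b - F a b'| ≤ Lb * |b - b'|) ∧
      (Δt / Δx) * La ≤ 1 / 2 ∧ (Δt / Δx) * Lb ≤ 1 / 2) :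
    ∀ N : ℕ, W1 (pc Δx (fun i => u i N)) (pc Δx (fun i => v i N)) ≤
      W1D Δx (fun i => u i 0) (fun i => v i 0) +
      Δt * ∑ n ∈ Finset.range N, W1D Δx (fun i => h i n) (fun i => g i n) := by
  have hr : 0 < Δt / Δx := div_pos hΔt hΔx
  have hab (n : ℕ) :
      IsContractiveStencil (fun i => Δt / Δx * A i n) fun i => -(Δt / Δx * B i n) := by
    have hB (i : ℤ) : B i n ≤ 0 := by simpa using hB0 (i + 1) n
    refine ⟨fun i => mul_nonneg hr.le (hA0 i n), fun i => ?_, fun i => ?_, fun i => ?_, fun i => ?_⟩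
    · exact neg_nonneg.2 (mul_nonpos_of_nonneg_of_nonpos hr.le (hB i))
    · have := hA1 (i + 1) n
      rw [add_sub_cancel_right] at this
      exact mul_le_mul_of_nonneg_left this hr.le
    · have := hB1 (i + 1) n
      rw [add_sub_cancel_right] at this
      exact neg_le_neg (mul_le_mul_of_nonneg_left this hr.le)
    · have := hABCFL (i + 1) n
      rw [add_sub_cancel_right] at this
      linarith
  have hs (n : ℕ) : SummableMoment fun i => h i n - g i n := by
    refine ((hsrc n).1.abs.add (hsrc n).2.2).congr fun i => ?_
    ring
  have hstep (n : ℕ) (i : ℤ) : u i (n + 1) - v i (n + 1) =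
      stencil (fun i => Δt / Δx * A i n) (fun i => -(Δt / Δx * B i n))
        (fun i => u i n - v i n) i + Δt * (h i n - g i n) := by
    have h1 := hdecomp i n
    have h2 := hdecomp (i - 1) n
    rw [sub_add_cancel] at h2
    rw [hu, hv, stencil]
    linear_combination (-(Δt / Δx)) * h1 + (Δt / Δx) * h2
  have hinv (n : ℕ) : SummableMoment (fun i => u i n - v i n) ∧ ∑' i, (u i n - v i n) = 0 := by
    induction n with
    | zero =>
      simp_rw [hu0, hv0]
      exact ⟨summableMoment_cellAvg_sub hΔx hu₀dec hv₀dec hint hmom,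
        tsum_cellAvg_sub hΔx hu₀dec hv₀dec hint hzero⟩
    | succ n ih =>
      have hm := (hab n).summableMoment ih.1
      have hm' := (hs n).bounded_mul (c := fun _ => Δt) fun _ => le_rfl
      simp_rw [hstep n]
      refine ⟨hm.add hm', ?_⟩
      rw [hm.summable.tsum_add hm'.summable, (hab n).tsum_stencil ih.1, ih.2, tsum_mul_left,
        (hsrc n).2.1]
      simp
  intro N
  refine (W1_pc_le_W1D hΔx (hinv N).1 (hinv N).2).trans ?_
  induction N with
  | zero => simp
  | succ n ih =>
    rw [Finset.sum_range_succ, mul_add, ← add_assoc]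
    exact (W1D_stencil_le hΔx.le hΔt.le (hab n) (hinv n).1 (hinv n).2 (hs n) (hsrc n).2.1
      (hstep n)).trans (add_le_add_left ih _)
end

section
/- Let u⁻ > u⁺ be real numbers, let X : [0,∞) → ℝ, let H(x,t) = u⁻ for x ≤ X(t) and H(x,t) = u⁺ for x > X(t), and let V(·,t) be a family of piecewise constant grid functions. Assume there are constants α, β > 0 such that for every t ≥ 0: |V(x + X(t), t) − u⁻| ≤ β e^{α x / Δx} for all x ≤ 0, |V(x + X(t), t) − u⁺| ≤ β e^{−α x / Δx} for all x ≥ 0, and ∫_ℝ ( H(x,t) − V(x,t) ) dx = 0. Then for all t ≥ 0, W₁( H(·,t), V(·,t) ) ≤ (2β/α²) Δx². -/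
open MeasureTheory

theorem integral_abs_mul_exp_neg_mul_abs {c : ℝ} (hc : 0 < c) :
    ∫ y : ℝ, |y| * Real.exp (-(c * |y|)) = 2 / c ^ 2 := by
  rw [integral_comp_abs (f := fun y => y * Real.exp (-(c * y)))]
  have h := Real.integral_rpow_mul_exp_neg_mul_Ioi (a := 2) (r := c) (by norm_num) hc
  norm_num at h
  rw [h]
  field_simp

theorem integrable_abs_mul_exp_neg_mul_abs {c : ℝ} (hc : 0 < c) :
    Integrable (fun y : ℝ => |y| * Real.exp (-(c * |y|))) :=
  Integrable.of_integral_ne_zero <| by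
    rw [integral_abs_mul_exp_neg_mul_abs hc]
    positivity

/-- A function of mean zero with exponential decay away from `a` has a small integral against
every `1`-Lipschitz function. -/
theorem integral_lipschitz_mul_le_of_exp_decay {w φ : ℝ → ℝ} {a b c : ℝ} (hb : 0 ≤ b) (hc : 0 < c)
    (hw : Integrable w) (hmean : ∫ x, w x = 0)
    (hdecay : ∀ x, |w x| ≤ b * Real.exp (-(c * |x - a|))) (hφ : LipschitzWith 1 φ) :
    ∫ x, φ x * w x ≤ 2 * b / c ^ 2 := by
  by_cases hint : Integrable (fun x => φ x * w x)
  · have hmajor : Integrable (fun x : ℝ => b * (|x - a| * Real.exp (-(c * |x - a|)))) :=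
      ((integrable_abs_mul_exp_neg_mul_abs hc).comp_sub_right a).const_mul b
    calc ∫ x, φ x * w x = ∫ x, (φ x * w x - φ a * w x) := by
          rw [integral_sub hint (hw.const_mul _), integral_const_mul, hmean, mul_zero, sub_zero]
      _ ≤ ∫ x, b * (|x - a| * Real.exp (-(c * |x - a|))) := by
          refine integral_mono (hint.sub (hw.const_mul _)) hmajor fun x => ?_
          have hlip : |φ x - φ a| ≤ |x - a| := by
            simpa [Real.dist_eq] using hφ.dist_le_mul x a
          calc φ x * w x - φ a * w x ≤ |(φ x - φ a) * w x| := by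
                rw [← sub_mul]; exact le_abs_self _
            _ ≤ |x - a| * (b * Real.exp (-(c * |x - a|))) := by
                rw [abs_mul]
                exact mul_le_mul hlip (hdecay x) (abs_nonneg _) (abs_nonneg _)
            _ = b * (|x - a| * Real.exp (-(c * |x - a|))) := by ring
      _ = 2 * b / c ^ 2 := by
          rw [integral_const_mul,
            integral_sub_right_eq_self (fun y : ℝ => |y| * Real.exp (-(c * |y|))) a,
            integral_abs_mul_exp_neg_mul_abs hc]
          ring
  · rw [integral_undef hint]
    positivity

/-- If a family of piecewise constant grid functions `V(·,t)` approaches the exact shock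
profile `H(·,t)` exponentially fast on the scale `Δx` on either side of the shock position
`X(t)`, and has the same mass, then its Wasserstein distance to the exact shock is at most
`(2β/α²) Δx²`. -/
theorem travelling_wave_wasserstein_error
    (Δx : ℝ) (hΔx : 0 < Δx)
    (um up : ℝ) (hjump : up < um)
    (X : ℝ → ℝ) (V : ℝ → ℤ → ℝ)
    (α β : ℝ) (hα : 0 < α) (hβ : 0 < β)
    (hdecay₁ : ∀ t : ℝ, 0 ≤ t → ∀ x : ℝ, x ≤ 0 →
      |pc Δx (V t) (x + X t) - um| ≤ β * Real.exp (α * x / Δx))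
    (hdecay₂ : ∀ t : ℝ, 0 ≤ t → ∀ x : ℝ, 0 ≤ x →
      |pc Δx (V t) (x + X t) - up| ≤ β * Real.exp (-α * x / Δx))
    (hintegrable : ∀ t : ℝ, 0 ≤ t →
      Integrable (fun x : ℝ => (if x ≤ X t then um else up) - pc Δx (V t) x))
    (hmass : ∀ t : ℝ, 0 ≤ t →
      (∫ x : ℝ, ((if x ≤ X t then um else up) - pc Δx (V t) x)) = 0) :
    ∀ t : ℝ, 0 ≤ t →
      W1 (fun x => if x ≤ X t then um else up) (pc Δx (V t)) ≤ (2 * β / α ^ 2) * Δx ^ 2 := by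
  intro t ht
  refine Real.sSup_le ?_ (by positivity)
  rintro r ⟨φ, hφ, rfl⟩
  have hdecay : ∀ x, |(if x ≤ X t then um else up) - pc Δx (V t) x| ≤
      β * Real.exp (-(α / Δx * |x - X t|)) := by
    intro x
    rw [abs_sub_comm]
    rcases le_or_gt x (X t) with hx | hx
    · have h := hdecay₁ t ht (x - X t) (by linarith)
      rw [sub_add_cancel] at h
      rw [if_pos hx, abs_of_nonpos (by linarith : x - X t ≤ 0)]
      convert h using 3
      ring
    · have h := hdecay₂ t ht (x - X t) (by linarith)
      rw [sub_add_cancel] at h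
      rw [if_neg (not_le.2 hx), abs_of_pos (by linarith : 0 < x - X t)]
      convert h using 3
      ring
  refine (integral_lipschitz_mul_le_of_exp_decay hβ.le (div_pos hα hΔx) (hintegrable t ht)
    (hmass t ht) hdecay hφ).trans_eq ?_
  field_simp
end
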